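/- Let (c(n))_{n≥0} be the coefficient sequence of a quasimodular Eisenstein series. Then either c(p) = 0 for every prime p, or the set of primes p with c(p) = 0 is finite. -/

import Mathlib

open Complex Filter Finset

noncomputable section

/-- `a` is the Fourier coefficient sequence of the cusp form `f` of weight `k` for `SL₂(ℤ)`:
`f(τ) = Σ_{n ≥ 1} a(n) e^{2πinτ}` (with `a 0 = 0`). -/
def CuspFormCoeffs (k : ℤ) (f : CuspForm (CongruenceSubgroup.Gamma 1) k) (a : ℕ → ℂ) : Prop :=
  a 0 = 0 ∧ ∀ τ : UpperHalfPlane,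
    Summable (fun n : ℕ => a n * Complex.exp (2 * (Real.pi : ℂ) * Complex.I * (n : ℂ) * (τ : ℂ))) ∧
    f τ = ∑' n : ℕ, a n * Complex.exp (2 * (Real.pi : ℂ) * Complex.I * (n : ℂ) * (τ : ℂ))

/-- `S` is the coefficient sequence of a quasimodular cusp form for `SL₂(ℤ)`, i.e. of a linear
combination of cusp forms and their iterated derivatives under `D = q d/dq`. -/
def IsQuasiCuspCoeff (S : ℕ → ℂ) : Prop :=
  ∃ (m : ℕ) (A : Fin m → ℂ) (j : Fin m → ℕ) (k : Fin m → ℤ)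
    (f : ∀ i, CuspForm (CongruenceSubgroup.Gamma 1) (k i)) (a : Fin m → ℕ → ℂ),
    (∀ i, CuspFormCoeffs (k i) (f i) (a i)) ∧ S 0 = 0 ∧
      ∀ n : ℕ, 1 ≤ n → S n = ∑ i, A i * (n : ℂ) ^ (j i) * a i n

/-- `E` is the coefficient sequence of a quasimodular Eisenstein series, i.e. of a linear
combination of the Eisenstein series `G_k` and their iterated derivatives under `D = q d/dq`. -/
def IsQuasiEisCoeff (E : ℕ → ℂ) : Prop :=
  ∃ (s : Finset (ℕ × ℕ)) (α : ℕ × ℕ → ℂ),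
    (∀ p ∈ s, 2 ≤ p.1 ∧ Even p.1) ∧
    E 0 = ∑ p ∈ s.filter (fun p => p.2 = 0), α p * (bernoulli p.1 : ℂ) / (2 * (p.1 : ℂ)) ∧
    ∀ n : ℕ, 1 ≤ n →
      E n = ∑ p ∈ s, α p * (n : ℂ) ^ p.2 * ((ArithmeticFunction.sigma (p.1 - 1) n : ℕ) : ℂ)

/-- The coefficients of a quasimodular Eisenstein series at primes are the values of a
polynomial. -/
theorem IsQuasiEisCoeff.exists_polynomial {c : ℕ → ℂ} (hc : IsQuasiEisCoeff c) :
    ∃ P : Polynomial ℂ, ∀ p : ℕ, p.Prime → c p = P.eval (p : ℂ) := by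
  obtain ⟨s, α, hs, -, hE⟩ := hc
  refine ⟨∑ x ∈ s, Polynomial.C (α x) * Polynomial.X ^ x.2 *
    (1 + Polynomial.X ^ (x.1 - 1)), fun p hp => ?_⟩
  rw [hE p hp.one_lt.le, Polynomial.eval_finsetSum]
  refine Finset.sum_congr rfl fun x _ => ?_
  have hσ : ArithmeticFunction.sigma (x.1 - 1) p = 1 + p ^ (x.1 - 1) := by
    rw [ArithmeticFunction.sigma_apply, hp.sum_divisors, one_pow, add_comm]
  simp [hσ]

/-- The coefficients of a quasimodular Eisenstein series either vanish at all primes or at only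
finitely many of them. -/
theorem eisenstein_vanishing_dichotomy (c : ℕ → ℂ) (hc : IsQuasiEisCoeff c) :
    (∀ p : ℕ, p.Prime → c p = 0) ∨ {p : ℕ | p.Prime ∧ c p = 0}.Finite := by
  obtain ⟨P, hP⟩ := hc.exists_polynomial
  by_cases h0 : P = 0
  · exact Or.inl fun p hp => by simp [hP p hp, h0]
  · refine Or.inr <| ((Polynomial.finite_setOfPred_isRoot h0).preimage
      Nat.cast_injective.injOn).subset fun p hp => ?_
    simpa [hP p hp.1] using hp.2
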